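/- arXiv:1703.03299 — 2 statements merged into one kernel-verified Lean document; each statement's English description precedes it below -/
import Mathlib

section
/- Let N ≥ 2 be an integer, 0 < s < 1 and p > 1 with ps < N. Let β satisfy −ps < β < (N−ps)/2 and set α = −2β/p. Then there exist positive constants C₁ and C₂, depending only on N, p, s, β, such that for all u ∈ C_c^∞(ℝ^N): C₁ · ∬_{ℝ^N×ℝ^N} | |x|^α u(x) − |y|^α u(y) |^p / |x−y|^{N+ps} dx dy ≤ ∬_{ℝ^N×ℝ^N} |u(x)−u(y)|^p / ( |x−y|^{N+ps} |x|^β |y|^β ) dx dy ≤ C₂ · ∬_{ℝ^N×ℝ^N} | |x|^α u(x) − |y|^α u(y) |^p / |x−y|^{N+ps} dx dy. -/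
open MeasureTheory Real Set Filter Metric
open scoped ENNReal Topology NNReal

noncomputable section

abbrev Euc (N : ℕ) := EuclideanSpace ℝ (Fin N)

/-- The weighted Gagliardo energy
`∬ |u(x)-u(y)|^p / (|x-y|^{N+ps} |x|^β |y|^β) dx dy` (valued in `ℝ≥0∞`). -/
def weightedGagliardoEnergy (N : ℕ) (p s β : ℝ) (u : Euc N → ℝ) : ℝ≥0∞ :=
  ∫⁻ x, ∫⁻ y, ENNReal.ofReal
    (|u x - u y| ^ p / (‖x - y‖ ^ ((N : ℝ) + p * s) * ‖x‖ ^ β * ‖y‖ ^ β))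

/-- The Gagliardo energy of `x ↦ |x|^α u(x)`:
`∬ ||x|^α u(x) - |y|^α u(y)|^p / |x-y|^{N+ps} dx dy` (valued in `ℝ≥0∞`). -/
def weightedFunctionEnergy (N : ℕ) (p s α : ℝ) (u : Euc N → ℝ) : ℝ≥0∞ :=
  ∫⁻ x, ∫⁻ y, ENNReal.ofReal
    (|‖x‖ ^ α * u x - ‖y‖ ^ α * u y| ^ p / ‖x - y‖ ^ ((N : ℝ) + p * s))

theorem lintegral_radial_scaling {N : ℕ} (hN : 2 ≤ N) {φ : ℝ → ℝ} (hφm : Measurable φ)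
    (hφ : IntegrableOn (fun t : ℝ => t ^ (N - 1) • φ t) (Ioi 0)) :
    ∃ C : ℝ, 0 ≤ C ∧ ∀ R : ℝ, 0 < R →
      ∫⁻ x : Euc N, ENNReal.ofReal (φ (‖x‖ / R)) = ENNReal.ofReal (C * R ^ N) := by
  have : Nonempty (Fin N) := ⟨⟨0, by omega⟩⟩
  have hint : Integrable (fun x : Euc N => φ ‖x‖) := by
    rw [integrable_fun_norm_addHaar]
    simpa using hφ
  refine ⟨(∫⁻ x : Euc N, ENNReal.ofReal (φ ‖x‖)).toReal, ENNReal.toReal_nonneg, fun R hR => ?_⟩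
  have hfin : ∫⁻ x : Euc N, ENNReal.ofReal (φ ‖x‖) ≠ ∞ := hint.lintegral_lt_top.ne
  have hmap := Measure.map_addHaar_smul (volume : Measure (Euc N)) hR.ne'
  have h : ∫⁻ x : Euc N, ENNReal.ofReal (φ (‖R • x‖ / R)) =
      ENNReal.ofReal |(R ^ N)⁻¹| * ∫⁻ x : Euc N, ENNReal.ofReal (φ (‖x‖ / R)) := by
    have hF : Measurable (fun x : Euc N => ENNReal.ofReal (φ (‖x‖ / R))) := by fun_prop
    rw [← lintegral_map (μ := volume) (f := fun x : Euc N => ENNReal.ofReal (φ (‖x‖ / R)))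
      (g := fun x : Euc N => R • x) hF (by fun_prop), hmap, lintegral_smul_measure]
    simp
  have h2 : ∀ x : Euc N, ‖R • x‖ / R = ‖x‖ := fun x => by
    rw [norm_smul, Real.norm_of_nonneg hR.le]; field_simp
  simp only [h2] at h
  rw [ENNReal.ofReal_mul ENNReal.toReal_nonneg, ENNReal.ofReal_toReal hfin, h,
    mul_comm, ← mul_assoc, ← ENNReal.ofReal_mul (by positivity), abs_of_pos (by positivity),
    mul_inv_cancel₀ (by positivity)]
  simp

theorem lintegral_norm_rpow_ball {N : ℕ} (hN : 2 ≤ N) {r : ℝ} (hr : -(N : ℝ) < r) :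
    ∃ C : ℝ, 0 ≤ C ∧ ∀ R : ℝ, 0 < R →
      ∫⁻ x : Euc N, ENNReal.ofReal (if ‖x‖ ≤ R then ‖x‖ ^ r else 0) =
        ENNReal.ofReal (C * R ^ (N + r)) := by
  obtain ⟨C, hC, h⟩ := lintegral_radial_scaling hN (φ := fun t => if t ≤ 1 then t ^ r else 0)
    (Measurable.ite measurableSet_Iic (by fun_prop) measurable_const) (by
      have h1 : IntegrableOn (fun t : ℝ => t ^ ((N : ℝ) - 1 + r)) (Ioc 0 1) :=
        (intervalIntegrable_iff_integrableOn_Ioc_of_le zero_le_one).1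
          (intervalIntegral.intervalIntegrable_rpow' (by linarith))
      rw [← integrable_indicator_iff measurableSet_Ioc] at h1
      rw [← integrable_indicator_iff measurableSet_Ioi]
      refine h1.congr (.of_forall fun t => ?_)
      by_cases ht : 0 < t
      · by_cases ht1 : t ≤ 1
        · simp only [indicator, mem_Ioc, ht, ht1, and_self, if_true, mem_Ioi, smul_eq_mul]
          rw [rpow_add ht, ← Real.rpow_natCast, Nat.cast_sub (by omega)]
          simp
        · simp [indicator, ht, ht1]
      · simp [indicator, ht])
  refine ⟨C, hC, fun R hR => ?_⟩
  have h1 : ∀ x : Euc N, ENNReal.ofReal (if ‖x‖ ≤ R then ‖x‖ ^ r else 0) =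
      ENNReal.ofReal (R ^ r) * ENNReal.ofReal (if ‖x‖ / R ≤ 1 then (‖x‖ / R) ^ r else 0) := by
    intro x
    simp only [div_le_one hR]
    rw [← ENNReal.ofReal_mul (by positivity), mul_ite, mul_zero,
      Real.div_rpow (norm_nonneg _) hR.le, mul_div_cancel₀ _ (by positivity)]
  simp only [h1]
  rw [lintegral_const_mul' _ _ ENNReal.ofReal_ne_top, h R hR, ← ENNReal.ofReal_mul (by positivity),
    rpow_add hR, Real.rpow_natCast]
  congr 1; ring

theorem lintegral_norm_rpow_compl_ball {N : ℕ} (hN : 2 ≤ N) {r : ℝ} (hr : r < -(N : ℝ)) :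
    ∃ C : ℝ, 0 ≤ C ∧ ∀ R : ℝ, 0 < R →
      ∫⁻ x : Euc N, ENNReal.ofReal (if R ≤ ‖x‖ then ‖x‖ ^ r else 0) =
        ENNReal.ofReal (C * R ^ (N + r)) := by
  obtain ⟨C, hC, h⟩ := lintegral_radial_scaling hN (φ := fun t => if 1 ≤ t then t ^ r else 0)
    (Measurable.ite measurableSet_Ici (by fun_prop) measurable_const) (by
      have h1 : IntegrableOn (fun t : ℝ => t ^ ((N : ℝ) - 1 + r)) (Ici 1) :=
        (integrableOn_Ici_iff_integrableOn_Ioi (by simp)).2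
          (integrableOn_Ioi_rpow_of_lt (by linarith) zero_lt_one)
      rw [← integrable_indicator_iff measurableSet_Ici] at h1
      rw [← integrable_indicator_iff measurableSet_Ioi]
      refine h1.congr (.of_forall fun t => ?_)
      by_cases ht1 : 1 ≤ t
      · have ht : 0 < t := by linarith
        simp only [indicator, mem_Ici, ht, ht1, if_true, mem_Ioi, smul_eq_mul]
        rw [rpow_add ht, ← Real.rpow_natCast, Nat.cast_sub (by omega)]
        simp
      · simp [indicator, ht1])
  refine ⟨C, hC, fun R hR => ?_⟩
  have h1 : ∀ x : Euc N, ENNReal.ofReal (if R ≤ ‖x‖ then ‖x‖ ^ r else 0) =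
      ENNReal.ofReal (R ^ r) * ENNReal.ofReal (if 1 ≤ ‖x‖ / R then (‖x‖ / R) ^ r else 0) := by
    intro x
    simp only [one_le_div hR]
    rw [← ENNReal.ofReal_mul (by positivity), mul_ite, mul_zero,
      Real.div_rpow (norm_nonneg _) hR.le, mul_div_cancel₀ _ (by positivity)]
  simp only [h1]
  rw [lintegral_const_mul' _ _ ENNReal.ofReal_ne_top, h R hR, ← ENNReal.ofReal_mul (by positivity),
    rpow_add hR, Real.rpow_natCast]
  congr 1; ring

theorem rpow_le_of_comparable {a b L : ℝ} (r : ℝ) (ha : 0 < a) (hb : 0 < b) (hL : 1 ≤ L)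
    (hab : a ≤ L * b) (hba : b ≤ L * a) : a ^ r ≤ L ^ |r| * b ^ r := by
  have hL0 : 0 < L := by linarith
  rcases le_total 0 r with hr | hr
  · rw [abs_of_nonneg hr, ← mul_rpow hL0.le hb.le]
    exact rpow_le_rpow ha.le hab hr
  · rw [abs_of_nonpos hr, rpow_neg hL0.le, ← inv_rpow hL0.le, ← mul_rpow (by positivity) hb.le]
    refine rpow_le_rpow_of_nonpos (by positivity) ?_ hr
    rw [inv_mul_le_iff₀ hL0]; exact hba

theorem abs_add_rpow_le {p a b c : ℝ} (hp : 1 < p) (ha : 0 ≤ a) (hb : 0 ≤ b) (hc : |c| ≤ a + b) :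
    |c| ^ p ≤ 2 ^ p * (a ^ p + b ^ p) := by
  have h1 : |c| ^ p ≤ (2 * max a b) ^ p := by
    refine rpow_le_rpow (abs_nonneg _) (hc.trans ?_) (by linarith)
    linarith [le_max_left a b, le_max_right a b]
  refine h1.trans ?_
  rw [mul_rpow (by norm_num) (ha.trans (le_max_left a b))]
  gcongr
  have := rpow_nonneg ha p
  have := rpow_nonneg hb p
  rcases max_choice a b with h | h <;> rw [h] <;> linarith

theorem abs_rpow_sub_rpow_le (σ : ℝ) {a b : ℝ} (hb : 0 < b) (h1 : b ≤ 2 * a) (h2 : a ≤ 2 * b) :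
    |a ^ σ - b ^ σ| ≤ |σ| * 2 ^ |σ - 1| * b ^ (σ - 1) * |a - b| := by
  have := (convex_Icc (b / 2) (2 * b)).norm_image_sub_le_of_norm_hasDerivWithin_le
    (f := fun t : ℝ => t ^ σ) (f' := fun t => σ * t ^ (σ - 1)) (x := b) (y := a)
    (C := |σ| * 2 ^ |σ - 1| * b ^ (σ - 1))
    (fun t ht => (hasDerivAt_rpow_const (Or.inl (by linarith [ht.1] : 0 < t).ne')).hasDerivWithinAt)
    (fun t ht => by
      have ht0 : 0 < t := by linarith [ht.1]
      rw [norm_mul, Real.norm_eq_abs, Real.norm_of_nonneg (by positivity), mul_assoc]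
      gcongr
      exact rpow_le_of_comparable _ ht0 hb one_le_two ht.2 (by linarith [ht.1]))
    ⟨by linarith, by linarith⟩ ⟨by linarith, by linarith⟩
  simpa using this

theorem weighted_difference_near_le {p q β c σ a b d : ℝ} (F G : ℝ) (hp : 1 < p)
    (hσ : σ * p = 2 * (β - c)) (ha : 0 < a) (hb : 0 < b) (hd : 0 < d) (hba : b ≤ 2 * a)
    (hab : a ≤ 2 * b) (hd' : |a - b| ≤ d) :
    |a ^ σ * F - b ^ σ * G| ^ p / (d ^ q * a ^ β * b ^ β) ≤
      2 ^ p * (2 ^ |β - c| + (|σ| * 2 ^ |σ - 1|) ^ p * 2 ^ |β|) *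
        (|F - G| ^ p / (d ^ q * a ^ c * b ^ c) +
          |G| ^ p * b ^ (-(2 * c)) * (d ^ (p - q) * b ^ (-p))) := by
  set K := |σ| * 2 ^ |σ - 1| with hK
  have hK0 : 0 ≤ K := by positivity
  have h1 : |a ^ σ * F - b ^ σ * G| ≤ a ^ σ * |F - G| + |G| * (K * b ^ (σ - 1) * d) := by
    have e : a ^ σ * F - b ^ σ * G = a ^ σ * (F - G) + G * (a ^ σ - b ^ σ) := by ring
    rw [e]
    refine (abs_add_le _ _).trans ?_
    rw [abs_mul, abs_mul, abs_of_pos (rpow_pos_of_pos ha σ)]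
    gcongr
    exact (abs_rpow_sub_rpow_le σ hb hba hab).trans (by gcongr)
  have h2 := abs_add_rpow_le hp (by positivity) (by positivity) h1
  have e1 : (a ^ σ * |F - G|) ^ p = a ^ (2 * (β - c)) * |F - G| ^ p := by
    rw [mul_rpow (by positivity) (abs_nonneg _), ← rpow_mul ha.le, hσ]
  have e2 : (|G| * (K * b ^ (σ - 1) * d)) ^ p =
      |G| ^ p * (K ^ p * b ^ (2 * (β - c) - p) * d ^ p) := by
    rw [mul_rpow (abs_nonneg _) (by positivity), mul_rpow (by positivity) hd.le,
      mul_rpow hK0 (by positivity), ← rpow_mul hb.le, sub_mul, one_mul, hσ]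
  rw [e1, e2] at h2
  have i1 : a ^ (2 * (β - c)) * (a ^ (-β) * b ^ (-β)) ≤ 2 ^ |β - c| * (a ^ (-c) * b ^ (-c)) := by
    have := rpow_le_of_comparable (β - c) ha hb one_le_two hab hba
    calc a ^ (2 * (β - c)) * (a ^ (-β) * b ^ (-β))
        = a ^ (β - c) * (a ^ (-c) * b ^ (-β)) := by
          rw [← mul_assoc, ← mul_assoc, ← rpow_add ha, ← rpow_add ha]; ring_nf
      _ ≤ (2 ^ |β - c| * b ^ (β - c)) * (a ^ (-c) * b ^ (-β)) := by gcongr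
      _ = 2 ^ |β - c| * (a ^ (-c) * (b ^ (β - c) * b ^ (-β))) := by ring
      _ = _ := by rw [← rpow_add hb]; ring_nf
  have i2 : b ^ (2 * (β - c) - p) * (a ^ (-β) * b ^ (-β)) ≤
      2 ^ |β| * (b ^ (-(2 * c)) * b ^ (-p)) := by
    have := rpow_le_of_comparable (-β) ha hb one_le_two hab hba
    rw [abs_neg] at this
    calc b ^ (2 * (β - c) - p) * (a ^ (-β) * b ^ (-β))
        ≤ b ^ (2 * (β - c) - p) * ((2 ^ |β| * b ^ (-β)) * b ^ (-β)) := by gcongr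
      _ = 2 ^ |β| * (b ^ (2 * (β - c) - p) * b ^ (-β) * b ^ (-β)) := by ring
      _ = _ := by rw [← rpow_add hb, ← rpow_add hb, ← rpow_add hb]; ring_nf
  have e3 : ∀ X r : ℝ, X / (d ^ q * a ^ r * b ^ r) = X * (d ^ (-q) * (a ^ (-r) * b ^ (-r))) := by
    intro X r
    rw [rpow_neg hd.le, rpow_neg ha.le, rpow_neg hb.le, div_eq_mul_inv, mul_inv, mul_inv, mul_assoc]
  rw [e3, e3]
  calc |a ^ σ * F - b ^ σ * G| ^ p * (d ^ (-q) * (a ^ (-β) * b ^ (-β)))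
      ≤ (2 ^ p * (a ^ (2 * (β - c)) * |F - G| ^ p +
          |G| ^ p * (K ^ p * b ^ (2 * (β - c) - p) * d ^ p))) *
            (d ^ (-q) * (a ^ (-β) * b ^ (-β))) := by gcongr
    _ = 2 ^ p * (|F - G| ^ p * d ^ (-q) * (a ^ (2 * (β - c)) * (a ^ (-β) * b ^ (-β))) +
          |G| ^ p * K ^ p * (d ^ p * d ^ (-q)) *
            (b ^ (2 * (β - c) - p) * (a ^ (-β) * b ^ (-β)))) := by ring
    _ ≤ 2 ^ p * (|F - G| ^ p * d ^ (-q) * (2 ^ |β - c| * (a ^ (-c) * b ^ (-c))) +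
          |G| ^ p * K ^ p * (d ^ p * d ^ (-q)) * (2 ^ |β| * (b ^ (-(2 * c)) * b ^ (-p)))) := by
        gcongr
    _ = 2 ^ p * (2 ^ |β - c| * (|F - G| ^ p * (d ^ (-q) * (a ^ (-c) * b ^ (-c)))) +
          K ^ p * 2 ^ |β| * (|G| ^ p * b ^ (-(2 * c)) * (d ^ (p - q) * b ^ (-p)))) := by
        rw [← rpow_add hd, ← sub_eq_add_neg p q]; ring
    _ ≤ _ := by
        rw [mul_assoc (2 ^ p)]
        gcongr
        have hX : 0 ≤ |F - G| ^ p * (d ^ (-q) * (a ^ (-c) * b ^ (-c))) := by positivity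
        have hY : 0 ≤ |G| ^ p * b ^ (-(2 * c)) * (d ^ (p - q) * b ^ (-p)) := by positivity
        have h3 : (0 : ℝ) ≤ 2 ^ |β - c| := by positivity
        have h4 : 0 ≤ K ^ p * 2 ^ |β| := by positivity
        nlinarith [mul_nonneg h3 hY, mul_nonneg h4 hX]

theorem weighted_difference_far_le {p q β c σ a b d : ℝ} (F G : ℝ) (hp : 1 < p) (hq : 0 ≤ q)
    (hσ : σ * p = 2 * (β - c)) (ha : 0 < a) (hb : 0 < b) (hd : 0 < d) (hbd : b ≤ 2 * d) :
    |a ^ σ * F - b ^ σ * G| ^ p / (d ^ q * a ^ β * b ^ β) ≤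
      2 ^ p * 2 ^ q *
        (|F| ^ p * a ^ (-(2 * c)) * (b ^ (-β - q) * a ^ β) +
          |G| ^ p * b ^ (-(2 * c)) * (a ^ (-β) * b ^ (β - q))) := by
  have h1 : |a ^ σ * F - b ^ σ * G| ≤ a ^ σ * |F| + b ^ σ * |G| := by
    refine (abs_sub _ _).trans_eq ?_
    rw [abs_mul, abs_mul, abs_of_pos (rpow_pos_of_pos ha σ), abs_of_pos (rpow_pos_of_pos hb σ)]
  have h2 := abs_add_rpow_le hp (by positivity) (by positivity) h1
  have e1 : ∀ {t : ℝ} (X : ℝ), 0 < t → (t ^ σ * |X|) ^ p = t ^ (2 * (β - c)) * |X| ^ p := by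
    intro t X ht
    rw [mul_rpow (by positivity) (abs_nonneg _), ← rpow_mul ht.le, hσ]
  rw [e1 F ha, e1 G hb] at h2
  have h3 : d ^ (-q) ≤ 2 ^ q * b ^ (-q) := by
    rw [rpow_neg hd.le, rpow_neg hb.le, ← div_eq_mul_inv, ← div_rpow (by norm_num) hb.le,
      ← inv_rpow hd.le]
    refine rpow_le_rpow (by positivity) ?_ hq
    rw [inv_eq_one_div, div_le_div_iff₀ hd hb]; linarith
  have e3 : ∀ X r : ℝ, X / (d ^ q * a ^ r * b ^ r) = X * (d ^ (-q) * (a ^ (-r) * b ^ (-r))) := by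
    intro X r
    rw [rpow_neg hd.le, rpow_neg ha.le, rpow_neg hb.le, div_eq_mul_inv, mul_inv, mul_inv, mul_assoc]
  rw [e3]
  calc |a ^ σ * F - b ^ σ * G| ^ p * (d ^ (-q) * (a ^ (-β) * b ^ (-β)))
      ≤ (2 ^ p * (a ^ (2 * (β - c)) * |F| ^ p + b ^ (2 * (β - c)) * |G| ^ p)) *
            (2 ^ q * b ^ (-q) * (a ^ (-β) * b ^ (-β))) := by gcongr
    _ = 2 ^ p * 2 ^ q * (|F| ^ p * (a ^ (2 * (β - c)) * a ^ (-β)) * (b ^ (-β) * b ^ (-q)) +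
          |G| ^ p * (b ^ (2 * (β - c)) * b ^ (-β) * b ^ (-q)) * a ^ (-β)) := by ring
    _ = 2 ^ p * 2 ^ q * (|F| ^ p * (a ^ (-(2 * c)) * a ^ β) * b ^ (-β - q) +
          |G| ^ p * (b ^ (-(2 * c)) * b ^ (β - q)) * a ^ (-β)) := by
        simp only [← rpow_add ha, ← rpow_add hb]; ring_nf
    _ = _ := by ring

/-- The kernel of the weighted Gagliardo energy. -/
def gagliardoKernel {N : ℕ} (p q β : ℝ) (u : Euc N → ℝ) (x y : Euc N) : ℝ :=
  |u x - u y| ^ p / (‖x - y‖ ^ q * ‖x‖ ^ β * ‖y‖ ^ β)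

/-- A homogeneous kernel dominating the error made when a power weight is moved inside the
difference in the Gagliardo kernel. -/
def remainderKernel {N : ℕ} (p q β : ℝ) (y x : Euc N) : ℝ :=
  (if ‖x - y‖ ≤ 3 * ‖y‖ then ‖x - y‖ ^ (p - q) else 0) * ‖y‖ ^ (-p) +
    (if ‖x‖ ≤ ‖y‖ / 2 then ‖x‖ ^ (-β) else 0) * ‖y‖ ^ (β - q) +
    (if 2 * ‖y‖ ≤ ‖x‖ then ‖x‖ ^ (-β - q) else 0) * ‖y‖ ^ β

theorem gagliardoKernel_nonneg {N : ℕ} (p q β : ℝ) (u : Euc N → ℝ) (x y : Euc N) :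
    0 ≤ gagliardoKernel p q β u x y := by
  unfold gagliardoKernel; positivity

theorem remainderKernel_nonneg {N : ℕ} (p q β : ℝ) (y x : Euc N) :
    0 ≤ remainderKernel p q β y x := by
  unfold remainderKernel
  refine add_nonneg (add_nonneg ?_ ?_) ?_ <;> refine mul_nonneg ?_ (by positivity) <;>
    split_ifs <;> positivity

theorem measurable_gagliardoKernel {N : ℕ} (p q β : ℝ) {u : Euc N → ℝ} (hu : Measurable u) :
    Measurable (fun z : Euc N × Euc N => gagliardoKernel p q β u z.1 z.2) := by
  unfold gagliardoKernel; fun_prop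

theorem measurable_remainderKernel {N : ℕ} (p q β : ℝ) :
    Measurable (fun z : Euc N × Euc N => remainderKernel p q β z.1 z.2) := by
  unfold remainderKernel
  refine ((Measurable.mul ?_ (by fun_prop)).add (Measurable.mul ?_ (by fun_prop))).add
    (Measurable.mul ?_ (by fun_prop)) <;>
  exact Measurable.ite (measurableSet_le (by fun_prop) (by fun_prop)) (by fun_prop) (by fun_prop)

theorem gagliardoKernel_le {N : ℕ} {p q β c σ : ℝ} (hp : 1 < p) (hq : 0 ≤ q)
    (hσ : σ * p = 2 * (β - c)) :
    ∃ C : ℝ, 0 ≤ C ∧ ∀ f g : Euc N → ℝ, (∀ x, x ≠ 0 → g x = ‖x‖ ^ σ * f x) →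
      ∀ x y : Euc N, x ≠ 0 → y ≠ 0 → gagliardoKernel p q β g x y ≤
        C * (gagliardoKernel p q c f x y +
          (|f y| ^ p * ‖y‖ ^ (-(2 * c)) * remainderKernel p q β y x +
            |f x| ^ p * ‖x‖ ^ (-(2 * c)) * remainderKernel p q β x y)) := by
  set C₁ : ℝ := 2 ^ p * (2 ^ |β - c| + (|σ| * 2 ^ |σ - 1|) ^ p * 2 ^ |β|) with hC₁
  set C₂ : ℝ := 2 ^ p * 2 ^ q with hC₂
  have hC₁0 : 0 ≤ C₁ := by positivity
  have hC₂0 : 0 ≤ C₂ := by positivity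
  refine ⟨C₁ + C₂, by positivity, fun f g hfg x y hx hy => ?_⟩
  have hK := gagliardoKernel_nonneg p q c f x y
  have hR₁ := remainderKernel_nonneg p q β x y
  have hR₂ := remainderKernel_nonneg p q β y x
  set hfx := |f x| ^ p * ‖x‖ ^ (-(2 * c)) with hfx_def
  set hfy := |f y| ^ p * ‖y‖ ^ (-(2 * c)) with hfy_def
  have hfx0 : 0 ≤ hfx := by positivity
  have hfy0 : 0 ≤ hfy := by positivity
  rcases eq_or_ne x y with rfl | hxy
  · have : gagliardoKernel p q β g x x = 0 := by
      simp [gagliardoKernel, zero_rpow (by linarith : p ≠ 0)]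
    rw [this]; positivity
  have ha : 0 < ‖x‖ := norm_pos_iff.2 hx
  have hb : 0 < ‖y‖ := norm_pos_iff.2 hy
  have hd : 0 < ‖x - y‖ := norm_pos_iff.2 (sub_ne_zero.2 hxy)
  have hd' : |‖x‖ - ‖y‖| ≤ ‖x - y‖ := abs_norm_sub_norm_le x y
  have hd'' : ‖x - y‖ ≤ ‖x‖ + ‖y‖ := norm_sub_le x y
  have hab := abs_le.1 hd'
  have mono : ∀ {D T : ℝ}, 0 ≤ D → D ≤ C₁ + C₂ → gagliardoKernel p q β g x y ≤ D * T →
      T ≤ gagliardoKernel p q c f x y +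
        (hfy * remainderKernel p q β y x + hfx * remainderKernel p q β x y) →
      gagliardoKernel p q β g x y ≤ (C₁ + C₂) * (gagliardoKernel p q c f x y +
        (hfy * remainderKernel p q β y x + hfx * remainderKernel p q β x y)) :=
    fun hD hDC h hT => h.trans ((mul_le_mul_of_nonneg_left hT hD).trans
      (mul_le_mul_of_nonneg_right hDC (by positivity)))
  by_cases h1 : ‖x‖ ≤ ‖y‖ / 2
  · refine mono hC₂0 (by linarith) ?_ (le_add_of_nonneg_of_le hK le_rfl)
    have := weighted_difference_far_le (f x) (f y) hp hq hσ ha hb hd (by linarith)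
    rw [gagliardoKernel, hfg x hx, hfg y hy]
    refine this.trans (mul_le_mul_of_nonneg_left ?_ hC₂0)
    rw [add_comm]
    refine add_le_add (mul_le_mul_of_nonneg_left ?_ hfy0) (mul_le_mul_of_nonneg_left ?_ hfx0)
    · rw [remainderKernel, if_pos h1, add_right_comm]
      refine le_add_of_nonneg_left (add_nonneg ?_ ?_) <;> refine mul_nonneg ?_ (by positivity) <;>
        split_ifs <;> positivity
    · rw [remainderKernel, if_pos (by linarith : 2 * ‖x‖ ≤ ‖y‖)]
      refine le_add_of_nonneg_left (add_nonneg ?_ ?_) <;> refine mul_nonneg ?_ (by positivity) <;>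
        split_ifs <;> positivity
  by_cases h2 : ‖y‖ ≤ ‖x‖ / 2
  · refine mono hC₂0 (by linarith) ?_ (le_add_of_nonneg_of_le hK le_rfl)
    have := weighted_difference_far_le (f y) (f x) hp hq hσ hb ha hd (by linarith)
    rw [gagliardoKernel, hfg x hx, hfg y hy, abs_sub_comm, mul_right_comm]
    refine this.trans (mul_le_mul_of_nonneg_left ?_ hC₂0)
    refine add_le_add (mul_le_mul_of_nonneg_left ?_ hfy0) (mul_le_mul_of_nonneg_left ?_ hfx0)
    · rw [remainderKernel, if_pos (by linarith : 2 * ‖y‖ ≤ ‖x‖)]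
      refine le_add_of_nonneg_left (add_nonneg ?_ ?_) <;> refine mul_nonneg ?_ (by positivity) <;>
        split_ifs <;> positivity
    · rw [remainderKernel, if_pos h2, add_right_comm]
      refine le_add_of_nonneg_left (add_nonneg ?_ ?_) <;> refine mul_nonneg ?_ (by positivity) <;>
        split_ifs <;> positivity
  push Not at h1 h2
  refine mono (T := gagliardoKernel p q c f x y + hfy * (‖x - y‖ ^ (p - q) * ‖y‖ ^ (-p)))
    hC₁0 (by linarith) ?_ ?_
  · have := weighted_difference_near_le (q := q) (f x) (f y) hp hσ ha hb hd (by linarith)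
      (by linarith) hd'
    rw [gagliardoKernel, hfg x hx, hfg y hy]
    exact this
  · refine add_le_add le_rfl (le_add_of_le_of_nonneg (mul_le_mul_of_nonneg_left ?_ hfy0)
      (by positivity))
    rw [remainderKernel, if_pos (by linarith : ‖x - y‖ ≤ 3 * ‖y‖), add_assoc]
    refine le_add_of_nonneg_right (add_nonneg ?_ ?_) <;> refine mul_nonneg ?_ (by positivity) <;>
        split_ifs <;> positivity

theorem ae_ne_zero {N : ℕ} (hN : 2 ≤ N) : ∀ᵐ x : Euc N, x ≠ 0 := by
  have : Nonempty (Fin N) := ⟨⟨0, by omega⟩⟩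
  simp [ae_iff]

theorem lintegral_remainderKernel_le {N : ℕ} (hN : 2 ≤ N) {p q β : ℝ} (hpq : q - N < p)
    (hβ : β < N) (hβq : N < β + q) :
    ∃ C : ℝ, 0 ≤ C ∧ ∀ y : Euc N, y ≠ 0 →
      ∫⁻ x, ENNReal.ofReal (remainderKernel p q β y x) ≤
        ENNReal.ofReal (C * ‖y‖ ^ ((N : ℝ) - q)) := by
  obtain ⟨C₁, hC₁, h₁⟩ := lintegral_norm_rpow_ball hN (r := p - q) (by linarith)
  obtain ⟨C₂, hC₂, h₂⟩ := lintegral_norm_rpow_ball hN (r := -β) (by linarith)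
  obtain ⟨C₃, hC₃, h₃⟩ := lintegral_norm_rpow_compl_ball hN (r := -β - q) (by linarith)
  refine ⟨C₁ * 3 ^ (N + (p - q)) + C₂ * (1 / 2) ^ (N + -β) + C₃ * 2 ^ (N + (-β - q)),
    by positivity, fun y hy => ?_⟩
  have hb : 0 < ‖y‖ := norm_pos_iff.2 hy
  have i₁ : ∫⁻ x : Euc N, ENNReal.ofReal (if ‖x - y‖ ≤ 3 * ‖y‖ then ‖x - y‖ ^ (p - q) else 0) =
      ENNReal.ofReal (C₁ * (3 * ‖y‖) ^ (N + (p - q))) := by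
    rw [← h₁ (3 * ‖y‖) (by positivity)]
    exact lintegral_sub_right_eq_self
      (fun x : Euc N => ENNReal.ofReal (if ‖x‖ ≤ 3 * ‖y‖ then ‖x‖ ^ (p - q) else 0)) y
  have i₂ := h₂ (‖y‖ / 2) (by positivity)
  have i₃ := h₃ (2 * ‖y‖) (by positivity)
  have split : ∀ x : Euc N, ENNReal.ofReal (remainderKernel p q β y x) =
      ENNReal.ofReal (if ‖x - y‖ ≤ 3 * ‖y‖ then ‖x - y‖ ^ (p - q) else 0) *
          ENNReal.ofReal (‖y‖ ^ (-p)) +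
        ENNReal.ofReal (if ‖x‖ ≤ ‖y‖ / 2 then ‖x‖ ^ (-β) else 0) *
          ENNReal.ofReal (‖y‖ ^ (β - q)) +
        ENNReal.ofReal (if 2 * ‖y‖ ≤ ‖x‖ then ‖x‖ ^ (-β - q) else 0) *
          ENNReal.ofReal (‖y‖ ^ β) := by
    intro x
    have n₁ : 0 ≤ if ‖x - y‖ ≤ 3 * ‖y‖ then ‖x - y‖ ^ (p - q) else 0 := by
      split_ifs <;> positivity
    have n₂ : 0 ≤ if ‖x‖ ≤ ‖y‖ / 2 then ‖x‖ ^ (-β) else 0 := by split_ifs <;> positivity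
    have n₃ : 0 ≤ if 2 * ‖y‖ ≤ ‖x‖ then ‖x‖ ^ (-β - q) else 0 := by split_ifs <;> positivity
    rw [remainderKernel, ENNReal.ofReal_add (by positivity) (by positivity),
      ENNReal.ofReal_add (by positivity) (by positivity), ENNReal.ofReal_mul n₁,
      ENNReal.ofReal_mul n₂, ENNReal.ofReal_mul n₃]
  have m₁ : Measurable fun x : Euc N =>
      ENNReal.ofReal (if ‖x - y‖ ≤ 3 * ‖y‖ then ‖x - y‖ ^ (p - q) else 0) :=
    (Measurable.ite (measurableSet_le (by fun_prop) (by fun_prop)) (by fun_prop)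
      (by fun_prop)).ennreal_ofReal
  have m₂ : Measurable fun x : Euc N =>
      ENNReal.ofReal (if ‖x‖ ≤ ‖y‖ / 2 then ‖x‖ ^ (-β) else 0) :=
    (Measurable.ite (measurableSet_le (by fun_prop) (by fun_prop)) (by fun_prop)
      (by fun_prop)).ennreal_ofReal
  have m₁₂ : Measurable fun x : Euc N =>
      ENNReal.ofReal (if ‖x - y‖ ≤ 3 * ‖y‖ then ‖x - y‖ ^ (p - q) else 0) *
          ENNReal.ofReal (‖y‖ ^ (-p)) +
        ENNReal.ofReal (if ‖x‖ ≤ ‖y‖ / 2 then ‖x‖ ^ (-β) else 0) *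
          ENNReal.ofReal (‖y‖ ^ (β - q)) := (m₁.mul_const _).add (m₂.mul_const _)
  simp only [split]
  rw [lintegral_add_left m₁₂,
    lintegral_add_left (m₁.mul_const _), lintegral_mul_const' _ _ ENNReal.ofReal_ne_top,
    lintegral_mul_const' _ _ ENNReal.ofReal_ne_top, lintegral_mul_const' _ _ ENNReal.ofReal_ne_top,
    i₁, i₂, i₃, ← ENNReal.ofReal_mul (by positivity), ← ENNReal.ofReal_mul (by positivity),
    ← ENNReal.ofReal_mul (by positivity), ← ENNReal.ofReal_add (by positivity) (by positivity),
    ← ENNReal.ofReal_add (by positivity) (by positivity)]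
  apply le_of_eq
  congr 1
  rw [mul_rpow (by norm_num) hb.le, mul_rpow (by norm_num) hb.le, div_eq_mul_inv,
    mul_rpow hb.le (by norm_num), add_mul, add_mul]
  have e : ∀ r t : ℝ, r + t = N - q → ‖y‖ ^ ((N : ℝ) - q) = ‖y‖ ^ r * ‖y‖ ^ t := by
    intro r t h; rw [← h, rpow_add hb]
  nth_rewrite 1 [e (N + (p - q)) (-p) (by ring)]
  nth_rewrite 1 [e (N + -β) (β - q) (by ring)]
  rw [e (N + (-β - q)) β (by ring)]
  norm_num
  ring

/-- The weighted integral `∫ |f|^p |x|^{N-q-2c}` controlled by the fractional Hardy inequality. -/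
def hardyIntegral {N : ℕ} (p q c : ℝ) (f : Euc N → ℝ) : ℝ≥0∞ :=
  ∫⁻ y, ENNReal.ofReal (|f y| ^ p * ‖y‖ ^ (-(2 * c)) * ‖y‖ ^ ((N : ℝ) - q))

theorem lintegral_lintegral_le_of_kernel_le {X : Type*} [MeasurableSpace X] {μ : Measure X}
    [SFinite μ] {K K' R : X → X → ℝ≥0∞} {h w : X → ℝ≥0∞} {C D : ℝ≥0∞} (hC : C ≠ ∞) (hD : D ≠ ∞)
    (hK : Measurable fun z : X × X => K z.1 z.2) (hR : Measurable fun z : X × X => R z.1 z.2)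
    (hh : Measurable h)
    (hle : ∀ᵐ x ∂μ, ∀ᵐ y ∂μ, K' x y ≤ C * (K x y + (h y * R y x + h x * R x y)))
    (hRw : ∀ᵐ y ∂μ, ∫⁻ x, R y x ∂μ ≤ D * w y) :
    ∫⁻ x, ∫⁻ y, K' x y ∂μ ∂μ ≤
      C * (∫⁻ x, ∫⁻ y, K x y ∂μ ∂μ + 2 * (D * ∫⁻ y, h y * w y ∂μ)) := by
  have m₁ : Measurable fun z : X × X => h z.1 * R z.1 z.2 := (hh.comp measurable_fst).mul hR
  have m₂ : Measurable fun z : X × X => h z.2 * R z.2 z.1 := m₁.comp measurable_swap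
  have mK : ∀ x, Measurable fun y => K x y := fun x => hK.comp measurable_prodMk_left
  have mR : ∀ x, Measurable fun y => R x y := fun x => hR.comp measurable_prodMk_left
  have m₂' : ∀ x, Measurable fun y => h y * R y x := fun x => m₂.comp measurable_prodMk_left
  have outer : ∫⁻ y, ∫⁻ x, h y * R y x ∂μ ∂μ ≤ D * ∫⁻ y, h y * w y ∂μ := by
    rw [← lintegral_const_mul' _ _ hD]
    refine lintegral_mono_ae ?_
    filter_upwards [hRw] with y hy
    rw [lintegral_const_mul _ (mR y), mul_left_comm]
    gcongr
  have swap : ∫⁻ x, ∫⁻ y, h y * R y x ∂μ ∂μ = ∫⁻ y, ∫⁻ x, h y * R y x ∂μ ∂μ :=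
    lintegral_lintegral_swap m₂.aemeasurable
  have inner : ∀ x, ∫⁻ y, C * (K x y + (h y * R y x + h x * R x y)) ∂μ =
      C * (∫⁻ y, K x y ∂μ + (∫⁻ y, h y * R y x ∂μ + ∫⁻ y, h x * R x y ∂μ)) := by
    intro x
    rw [lintegral_const_mul' _ _ hC, lintegral_add_left (mK x), lintegral_add_left (m₂' x)]
  calc ∫⁻ x, ∫⁻ y, K' x y ∂μ ∂μ
      ≤ ∫⁻ x, ∫⁻ y, C * (K x y + (h y * R y x + h x * R x y)) ∂μ ∂μ :=
        lintegral_mono_ae (hle.mono fun x hx => lintegral_mono_ae hx)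
    _ = C * (∫⁻ x, ∫⁻ y, K x y ∂μ ∂μ +
          (∫⁻ x, ∫⁻ y, h y * R y x ∂μ ∂μ + ∫⁻ x, ∫⁻ y, h x * R x y ∂μ ∂μ)) := by
        simp only [inner]
        rw [lintegral_const_mul' _ _ hC, lintegral_add_left hK.lintegral_prod_right',
          lintegral_add_left m₂.lintegral_prod_right']
    _ ≤ _ := by
        rw [swap, two_mul]; gcongr

theorem lintegral_gagliardoKernel_le_add_hardyIntegral {N : ℕ} (hN : 2 ≤ N) {p q β c σ : ℝ}
    (hp : 1 < p) (hq : 0 ≤ q) (hσ : σ * p = 2 * (β - c)) (hpq : q - N < p) (hβ : β < N)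
    (hβq : N < β + q) :
    ∃ C : ℝ, 0 ≤ C ∧ ∀ f g : Euc N → ℝ, Measurable f → (∀ x, x ≠ 0 → g x = ‖x‖ ^ σ * f x) →
      ∫⁻ x, ∫⁻ y, ENNReal.ofReal (gagliardoKernel p q β g x y) ≤
        ENNReal.ofReal C * ((∫⁻ x, ∫⁻ y, ENNReal.ofReal (gagliardoKernel p q c f x y)) +
          hardyIntegral p q c f) := by
  obtain ⟨C, hC, hK⟩ := gagliardoKernel_le (N := N) (β := β) (c := c) hp hq hσ
  obtain ⟨D, hD, hR⟩ := lintegral_remainderKernel_le hN hpq hβ hβq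
  refine ⟨C * (1 + 2 * D), by positivity, fun f g hf hfg => ?_⟩
  have h0 : ∀ x, 0 ≤ |f x| ^ p * ‖x‖ ^ (-(2 * c)) := fun x => by positivity
  have hm : Measurable fun x => |f x| ^ p * ‖x‖ ^ (-(2 * c)) := by fun_prop
  have := lintegral_lintegral_le_of_kernel_le (μ := (volume : Measure (Euc N)))
    (K := fun x y => ENNReal.ofReal (gagliardoKernel p q c f x y))
    (K' := fun x y => ENNReal.ofReal (gagliardoKernel p q β g x y))
    (R := fun x y => ENNReal.ofReal (remainderKernel p q β x y))
    (h := fun x => ENNReal.ofReal (|f x| ^ p * ‖x‖ ^ (-(2 * c))))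
    (w := fun y => ENNReal.ofReal (‖y‖ ^ ((N : ℝ) - q)))
    (C := ENNReal.ofReal C) (D := ENNReal.ofReal D) ENNReal.ofReal_ne_top ENNReal.ofReal_ne_top
    (measurable_gagliardoKernel p q c hf).ennreal_ofReal
    (measurable_remainderKernel p q β).ennreal_ofReal hm.ennreal_ofReal
    (by
      filter_upwards [ae_ne_zero hN] with x hx
      filter_upwards [ae_ne_zero hN] with y hy
      have n₁ := gagliardoKernel_nonneg p q c f x y
      have n₂ := mul_nonneg (h0 y) (remainderKernel_nonneg p q β y x)
      have n₃ := mul_nonneg (h0 x) (remainderKernel_nonneg p q β x y)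
      rw [← ENNReal.ofReal_mul (h0 y), ← ENNReal.ofReal_mul (h0 x), ← ENNReal.ofReal_add n₂ n₃,
        ← ENNReal.ofReal_add n₁ (by positivity), ← ENNReal.ofReal_mul hC]
      exact ENNReal.ofReal_le_ofReal (hK f g hfg x y hx hy))
    (by
      filter_upwards [ae_ne_zero hN] with y hy
      exact (hR y hy).trans_eq (ENNReal.ofReal_mul hD))
  refine this.trans ?_
  have hH : ∫⁻ y, ENNReal.ofReal (|f y| ^ p * ‖y‖ ^ (-(2 * c))) *
      ENNReal.ofReal (‖y‖ ^ ((N : ℝ) - q)) = hardyIntegral p q c f :=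
    lintegral_congr fun y => (ENNReal.ofReal_mul (h0 y)).symm
  rw [hH, ENNReal.ofReal_mul hC, mul_assoc, ENNReal.ofReal_add zero_le_one (by positivity),
    ENNReal.ofReal_one, ENNReal.ofReal_mul zero_le_two, ENNReal.ofReal_ofNat]
  refine mul_le_mul_right ?_ _
  rw [add_mul, one_mul, ← mul_assoc]
  exact add_le_add le_self_add (mul_le_mul_right le_add_self _)

theorem ball_shift_bounds {N : ℕ} {M : ℝ} (hM : 4 ≤ M) {x y : Euc N}
    (h : ‖y - M • x‖ ≤ M * ‖x‖ / 2) : M * ‖x‖ / 2 ≤ ‖y‖ ∧ ‖y‖ ≤ 2 * (M * ‖x‖) := by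
  have e : ‖M • x‖ = M * ‖x‖ := by rw [norm_smul, Real.norm_of_nonneg (by linarith)]
  have h1 := abs_le.1 (abs_norm_sub_norm_le y (M • x))
  rw [e] at h1
  have : 0 ≤ M * ‖x‖ := by positivity
  constructor <;> linarith [h1.1, h1.2]

theorem rpow_norm_le_gagliardoKernel_add {N : ℕ} {p q c M : ℝ} (hp : 1 < p) (hq : 0 ≤ q)
    (hM : 4 ≤ M)
    (f : Euc N → ℝ) {x y : Euc N} (hx : x ≠ 0) (h : ‖y - M • x‖ ≤ M * ‖x‖ / 2) :
    |f x| ^ p * ‖x‖ ^ (-(2 * c) - q) ≤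
      2 ^ p * ((3 * M) ^ q * (2 * M) ^ |c|) * gagliardoKernel p q c f x y +
        2 ^ p * (|f y| ^ p * ‖x‖ ^ (-(2 * c) - q)) := by
  obtain ⟨h1, h2⟩ := ball_shift_bounds hM h
  have ha : 0 < ‖x‖ := norm_pos_iff.2 hx
  have hMa : 4 * ‖x‖ ≤ M * ‖x‖ := by gcongr
  have hMM : M * ‖x‖ ≤ M * (M * ‖x‖) := le_mul_of_one_le_left (by positivity) (by linarith)
  have hb : 0 < ‖y‖ := by linarith
  have hd : 0 < ‖x - y‖ := by
    have := norm_sub_norm_le y x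
    rw [norm_sub_rev] at this; linarith
  have hd2 : ‖x - y‖ ≤ 3 * M * ‖x‖ := by linarith [norm_sub_le x y]
  have h3 : |f x| ^ p ≤ 2 ^ p * (|f x - f y| ^ p + |f y| ^ p) := by
    refine abs_add_rpow_le hp (abs_nonneg _) (abs_nonneg _) ?_
    have := abs_add_le (f x - f y) (f y)
    rwa [sub_add_cancel] at this
  have hden : ‖x - y‖ ^ q * ‖x‖ ^ c * ‖y‖ ^ c ≤
      (3 * M) ^ q * (2 * M) ^ |c| * ‖x‖ ^ (2 * c + q) := by
    have i1 : ‖x - y‖ ^ q ≤ (3 * M) ^ q * ‖x‖ ^ q := by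
      rw [← mul_rpow (by positivity) ha.le]
      exact rpow_le_rpow hd.le hd2 hq
    have i2 : ‖y‖ ^ c ≤ (2 * M) ^ |c| * ‖x‖ ^ c :=
      rpow_le_of_comparable c hb ha (by linarith) (by linarith) (by nlinarith)
    calc ‖x - y‖ ^ q * ‖x‖ ^ c * ‖y‖ ^ c
        ≤ ((3 * M) ^ q * ‖x‖ ^ q) * ‖x‖ ^ c * ((2 * M) ^ |c| * ‖x‖ ^ c) := by gcongr
      _ = (3 * M) ^ q * (2 * M) ^ |c| * (‖x‖ ^ q * ‖x‖ ^ c * ‖x‖ ^ c) := by ring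
      _ = _ := by rw [← rpow_add ha, ← rpow_add ha]; ring_nf
  have h4 : |f x - f y| ^ p * ‖x‖ ^ (-(2 * c) - q) ≤
      (3 * M) ^ q * (2 * M) ^ |c| * gagliardoKernel p q c f x y := by
    rw [gagliardoKernel, ← mul_div_assoc, le_div_iff₀ (by positivity),
      show -(2 * c) - q = -(2 * c + q) by ring, rpow_neg ha.le]
    calc |f x - f y| ^ p * (‖x‖ ^ (2 * c + q))⁻¹ * (‖x - y‖ ^ q * ‖x‖ ^ c * ‖y‖ ^ c)
        ≤ |f x - f y| ^ p * (‖x‖ ^ (2 * c + q))⁻¹ *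
          ((3 * M) ^ q * (2 * M) ^ |c| * ‖x‖ ^ (2 * c + q)) := by gcongr
      _ = _ := by
        have : ‖x‖ ^ (2 * c + q) ≠ 0 := by positivity
        field_simp
  calc |f x| ^ p * ‖x‖ ^ (-(2 * c) - q)
      ≤ 2 ^ p * (|f x - f y| ^ p + |f y| ^ p) * ‖x‖ ^ (-(2 * c) - q) := by gcongr
    _ = 2 ^ p * (|f x - f y| ^ p * ‖x‖ ^ (-(2 * c) - q)) +
        2 ^ p * (|f y| ^ p * ‖x‖ ^ (-(2 * c) - q)) := by ring
    _ ≤ _ := by rw [mul_assoc (2 ^ p)]; gcongr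

theorem lintegral_ball_shift_le {N : ℕ} {e M : ℝ} (hM : 4 ≤ M) {y : Euc N}
    (hy : y ≠ 0) :
    ∫⁻ x : Euc N, ENNReal.ofReal (if ‖y - M • x‖ ≤ M * ‖x‖ / 2 then ‖x‖ ^ e else 0) ≤
      ENNReal.ofReal (2 ^ |e| * 2 ^ (N : ℝ) * (‖y‖ / M) ^ (e + N)) *
        volume (closedBall (0 : Euc N) 1) := by
  have hb : 0 < ‖y‖ := norm_pos_iff.2 hy
  have hM0 : 0 < M := by linarith
  have hbM : 0 < ‖y‖ / M := by positivity
  have h1 : ∀ x : Euc N,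
      ENNReal.ofReal (if ‖y - M • x‖ ≤ M * ‖x‖ / 2 then ‖x‖ ^ e else 0) ≤
        (closedBall (0 : Euc N) (2 * (‖y‖ / M))).indicator
          (fun _ => ENNReal.ofReal (2 ^ |e| * (‖y‖ / M) ^ e)) x := by
    intro x
    split_ifs with h
    · obtain ⟨h2, h3⟩ := ball_shift_bounds hM h
      have h4 : ‖x‖ ≤ 2 * (‖y‖ / M) := by
        rw [← mul_div_assoc, le_div_iff₀ hM0]; linarith
      have h5 : ‖y‖ / M ≤ 2 * ‖x‖ := by rw [div_le_iff₀ hM0]; linarith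
      rw [indicator_of_mem (by simpa using h4)]
      exact ENNReal.ofReal_le_ofReal
        (rpow_le_of_comparable e (by linarith) hbM one_le_two h4 h5)
    · simp
  refine (lintegral_mono h1).trans_eq ?_
  rw [lintegral_indicator_const measurableSet_closedBall,
    Measure.addHaar_closedBall _ _ (by positivity), ← mul_assoc,
    ← ENNReal.ofReal_mul (by positivity),
    Measure.addHaar_unitClosedBall_eq_addHaar_unitBall]
  congr 2
  rw [finrank_euclideanSpace_fin, mul_pow, ← Real.rpow_natCast, ← Real.rpow_natCast,
    rpow_add hbM]
  ring

theorem exists_dilation_factor {A δ : ℝ} (hδ : 0 < δ) : ∃ M : ℝ, 4 ≤ M ∧ A ≤ M ^ δ :=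
  ((eventually_ge_atTop 4).and ((tendsto_rpow_atTop hδ).eventually_ge_atTop A)).exists

theorem lintegral_lintegral_ball_shift_left {N : ℕ} (hN : 2 ≤ N) {p q c M : ℝ} (hM : 4 ≤ M)
    (f : Euc N → ℝ) :
    ∫⁻ x : Euc N, ∫⁻ y : Euc N, ENNReal.ofReal
        (if ‖y - M • x‖ ≤ M * ‖x‖ / 2 then |f x| ^ p * ‖x‖ ^ (-(2 * c) - q) else 0) =
      ENNReal.ofReal ((M / 2) ^ (N : ℝ)) * volume (closedBall (0 : Euc N) 1) *
        hardyIntegral p q c f := by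
  have hM0 : 0 < M := by linarith
  rw [hardyIntegral, ← lintegral_const_mul' _ _
    (ENNReal.mul_ne_top ENNReal.ofReal_ne_top measure_closedBall_lt_top.ne)]
  refine lintegral_congr_ae ?_
  filter_upwards [ae_ne_zero hN] with x hx
  have ha : 0 < ‖x‖ := norm_pos_iff.2 hx
  have : (fun y : Euc N => ENNReal.ofReal
      (if ‖y - M • x‖ ≤ M * ‖x‖ / 2 then |f x| ^ p * ‖x‖ ^ (-(2 * c) - q) else 0)) =
      (closedBall (M • x) (M * ‖x‖ / 2)).indicator
        (fun _ => ENNReal.ofReal (|f x| ^ p * ‖x‖ ^ (-(2 * c) - q))) := by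
    ext y
    by_cases h : ‖y - M • x‖ ≤ M * ‖x‖ / 2
    · rw [indicator_of_mem (by simpa [dist_eq_norm] using h), if_pos h]
    · rw [indicator_of_notMem (by simpa [dist_eq_norm] using h), if_neg h, ENNReal.ofReal_zero]
  rw [this, lintegral_indicator_const measurableSet_closedBall,
    Measure.addHaar_closedBall _ _ (by positivity), ← mul_assoc,
    ← ENNReal.ofReal_mul (by positivity),
    mul_right_comm (ENNReal.ofReal _) (volume _), ← ENNReal.ofReal_mul (by positivity),
    Measure.addHaar_unitClosedBall_eq_addHaar_unitBall]
  congr 2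
  rw [finrank_euclideanSpace_fin, ← Real.rpow_natCast, mul_div_right_comm,
    mul_rpow (by positivity) ha.le]
  have : ‖x‖ ^ (-(2 * c)) * ‖x‖ ^ ((N : ℝ) - q) = ‖x‖ ^ (-(2 * c) - q) * ‖x‖ ^ (N : ℝ) := by
    rw [← rpow_add ha, ← rpow_add ha]; ring_nf
  linear_combination -(|f x| ^ p * (M / 2) ^ (N : ℝ)) * this

theorem lintegral_lintegral_ball_shift_right_le {N : ℕ} (hN : 2 ≤ N) {p q c e M : ℝ} (hM : 4 ≤ M)
    (he : e = -(2 * c) - q) {f : Euc N → ℝ} (hf : Measurable f) :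
    ∫⁻ x : Euc N, ∫⁻ y : Euc N, ENNReal.ofReal
        (if ‖y - M • x‖ ≤ M * ‖x‖ / 2 then |f y| ^ p * ‖x‖ ^ e else 0) ≤
      ENNReal.ofReal (2 ^ |e| * 2 ^ (N : ℝ) * M ^ (-(e + N))) *
        volume (closedBall (0 : Euc N) 1) * hardyIntegral p q c f := by
  have hM0 : 0 < M := by linarith
  have mT : Measurable fun z : Euc N × Euc N => ENNReal.ofReal
      (if ‖z.2 - M • z.1‖ ≤ M * ‖z.1‖ / 2 then |f z.2| ^ p * ‖z.1‖ ^ e else 0) :=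
    (Measurable.ite (measurableSet_le (by fun_prop) (by fun_prop)) (by fun_prop)
      (by fun_prop)).ennreal_ofReal
  rw [lintegral_lintegral_swap mT.aemeasurable, hardyIntegral, ← lintegral_const_mul' _ _
    (ENNReal.mul_ne_top ENNReal.ofReal_ne_top measure_closedBall_lt_top.ne)]
  refine lintegral_mono_ae ?_
  filter_upwards [ae_ne_zero hN] with y hy
  have hb : 0 < ‖y‖ := norm_pos_iff.2 hy
  have hsplit : ∀ x : Euc N, ENNReal.ofReal
      (if ‖y - M • x‖ ≤ M * ‖x‖ / 2 then |f y| ^ p * ‖x‖ ^ e else 0) =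
      ENNReal.ofReal (|f y| ^ p) *
        ENNReal.ofReal (if ‖y - M • x‖ ≤ M * ‖x‖ / 2 then ‖x‖ ^ e else 0) := by
    intro x
    rw [← ENNReal.ofReal_mul (by positivity), mul_ite, mul_zero]
  simp only [hsplit]
  rw [lintegral_const_mul' _ _ ENNReal.ofReal_ne_top]
  refine (mul_le_mul_right (lintegral_ball_shift_le hM hy) _).trans_eq ?_
  rw [← mul_assoc, ← ENNReal.ofReal_mul (by positivity),
    mul_right_comm (ENNReal.ofReal _) (volume _), ← ENNReal.ofReal_mul (by positivity)]
  congr 2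
  rw [div_rpow hb.le hM0.le, rpow_neg hM0.le]
  have : ‖y‖ ^ (-(2 * c)) * ‖y‖ ^ ((N : ℝ) - q) = ‖y‖ ^ (e + N) := by
    rw [← rpow_add hb, he]; ring_nf
  rw [mul_assoc (|f y| ^ p), this]
  ring

theorem lintegral_lintegral_le_add {X : Type*} [MeasurableSpace X] {μ : Measure X} [SFinite μ]
    {A K B : X → X → ℝ≥0∞} {C D : ℝ≥0∞} (hC : C ≠ ∞) (hD : D ≠ ∞)
    (hK : Measurable fun z : X × X => K z.1 z.2)
    (hle : ∀ᵐ x ∂μ, ∀ y, A x y ≤ C * K x y + D * B x y) :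
    ∫⁻ x, ∫⁻ y, A x y ∂μ ∂μ ≤
      C * (∫⁻ x, ∫⁻ y, K x y ∂μ ∂μ) + D * ∫⁻ x, ∫⁻ y, B x y ∂μ ∂μ := by
  have mK : ∀ x, Measurable fun y => K x y := fun x => hK.comp measurable_prodMk_left
  rw [← lintegral_const_mul' _ _ hC, ← lintegral_const_mul' _ _ hD,
    ← lintegral_add_left (hK.lintegral_prod_right'.const_mul _)]
  refine lintegral_mono_ae (hle.mono fun x hx => ?_)
  rw [← lintegral_const_mul' _ _ hC, ← lintegral_const_mul' _ _ hD,
    ← lintegral_add_left ((mK x).const_mul _)]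
  exact lintegral_mono hx

theorem lintegral_lintegral_ball_shift_le {N : ℕ} (hN : 2 ≤ N) {p q c M : ℝ} (hp : 1 < p)
    (hq : 0 ≤ q) (hM : 4 ≤ M) {f : Euc N → ℝ} (hf : Measurable f) :
    ∫⁻ x : Euc N, ∫⁻ y : Euc N, ENNReal.ofReal
        (if ‖y - M • x‖ ≤ M * ‖x‖ / 2 then |f x| ^ p * ‖x‖ ^ (-(2 * c) - q) else 0) ≤
      ENNReal.ofReal (2 ^ p * ((3 * M) ^ q * (2 * M) ^ |c|)) *
          (∫⁻ x, ∫⁻ y, ENNReal.ofReal (gagliardoKernel p q c f x y)) +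
        ENNReal.ofReal (2 ^ p) * ∫⁻ x : Euc N, ∫⁻ y : Euc N, ENNReal.ofReal
          (if ‖y - M • x‖ ≤ M * ‖x‖ / 2 then |f y| ^ p * ‖x‖ ^ (-(2 * c) - q) else 0) := by
  refine lintegral_lintegral_le_add (μ := (volume : Measure (Euc N)))
    (K := fun x y => ENNReal.ofReal (gagliardoKernel p q c f x y))
    ENNReal.ofReal_ne_top ENNReal.ofReal_ne_top
    (measurable_gagliardoKernel p q c hf).ennreal_ofReal ?_
  filter_upwards [ae_ne_zero hN] with x hx y
  have hM0 : 0 < M := by linarith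
  by_cases h : ‖y - M • x‖ ≤ M * ‖x‖ / 2
  · have hK := gagliardoKernel_nonneg p q c f x y
    rw [if_pos h, if_pos h, ← ENNReal.ofReal_mul (by positivity),
      ← ENNReal.ofReal_mul (by positivity), ← ENNReal.ofReal_add (by positivity) (by positivity)]
    exact ENNReal.ofReal_le_ofReal (rpow_norm_le_gagliardoKernel_add hp hq hM f hx h)
  · rw [if_neg h, ENNReal.ofReal_zero]
    exact zero_le

/-- Weighted fractional Hardy inequality for functions with finite left-hand side. -/
theorem hardyIntegral_le {N : ℕ} (hN : 2 ≤ N) {p q c : ℝ} (hp : 1 < p) (hq : 0 ≤ q)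
    (hc : 2 * c + q < 2 * N) :
    ∃ C : ℝ, 0 ≤ C ∧ ∀ f : Euc N → ℝ, Measurable f → hardyIntegral p q c f ≠ ∞ →
      hardyIntegral p q c f ≤
        ENNReal.ofReal C * ∫⁻ x, ∫⁻ y, ENNReal.ofReal (gagliardoKernel p q c f x y) := by
  obtain ⟨e, he⟩ : ∃ e, e = -(2 * c) - q := ⟨_, rfl⟩
  obtain ⟨M, hM, hMA⟩ := exists_dilation_factor
    (A := 2 ^ p * 2 ^ |e| * 2 ^ (N : ℝ) * 2 * 2 ^ (N : ℝ)) (δ := e + 2 * N) (by linarith)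
  have hM0 : 0 < M := by linarith
  obtain ⟨L, hL⟩ : ∃ L : ℝ, L = 2 ^ p * ((3 * M) ^ q * (2 * M) ^ |c|) := ⟨_, rfl⟩
  have hL0 : 0 ≤ L := by rw [hL]; positivity
  obtain ⟨Q, hQ⟩ : ∃ Q : ℝ, Q = (M / 2) ^ (N : ℝ) / 2 := ⟨_, rfl⟩
  have hQ0 : 0 < Q := by rw [hQ]; positivity
  have absorb : (2 : ℝ) ^ p * (2 ^ |e| * 2 ^ (N : ℝ) * M ^ (-(e + N))) ≤ Q := by
    have e1 : M ^ (e + 2 * (N : ℝ)) = M ^ (e + N) * M ^ (N : ℝ) := by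
      rw [← rpow_add hM0]; ring_nf
    have e2 : (M / 2) ^ (N : ℝ) = M ^ (N : ℝ) / 2 ^ (N : ℝ) := div_rpow hM0.le (by norm_num) _
    rw [e1] at hMA
    rw [hQ, e2, rpow_neg hM0.le, div_div, le_div_iff₀ (by positivity)]
    calc 2 ^ p * (2 ^ |e| * 2 ^ (N : ℝ) * (M ^ (e + N))⁻¹) * (2 ^ (N : ℝ) * 2)
        = (2 ^ p * 2 ^ |e| * 2 ^ (N : ℝ) * 2 * 2 ^ (N : ℝ)) * (M ^ (e + N))⁻¹ := by ring
      _ ≤ (M ^ (e + N) * M ^ (N : ℝ)) * (M ^ (e + N))⁻¹ := by gcongr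
      _ = _ := by
        have : M ^ (e + N) ≠ 0 := by positivity
        field_simp
  have hκ0 : volume (closedBall (0 : Euc N) 1) ≠ 0 :=
    (measure_closedBall_pos volume _ one_pos).ne'
  have hκt : volume (closedBall (0 : Euc N) 1) ≠ ∞ := measure_closedBall_lt_top.ne
  refine ⟨L / ((volume (closedBall (0 : Euc N) 1)).toReal * Q), by positivity,
    fun f hf hfin => ?_⟩
  have main := lintegral_lintegral_ball_shift_le hN (c := c) hp hq hM hf
  rw [lintegral_lintegral_ball_shift_left hN hM f, ← hL, ← he] at main
  have right := lintegral_lintegral_ball_shift_right_le hN (p := p) hM he hf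
  generalize volume (closedBall (0 : Euc N) 1) = κ at *
  generalize (∫⁻ x, ∫⁻ y, ENNReal.ofReal (gagliardoKernel p q c f x y)) = W at *
  generalize hardyIntegral p q c f = H at *
  have main' : ENNReal.ofReal Q * κ * H + ENNReal.ofReal Q * κ * H ≤
      ENNReal.ofReal L * W + ENNReal.ofReal Q * κ * H := by
    have hQQ : (M / 2) ^ (N : ℝ) = Q + Q := by rw [hQ]; ring
    rw [hQQ, ENNReal.ofReal_add hQ0.le hQ0.le, add_mul, add_mul] at main
    refine main.trans (add_le_add le_rfl ((mul_le_mul_right right _).trans ?_))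
    rw [← mul_assoc, ← mul_assoc, ← ENNReal.ofReal_mul (by positivity)]
    gcongr
  have key := ENNReal.le_of_add_le_add_right
    (ENNReal.mul_ne_top (ENNReal.mul_ne_top ENNReal.ofReal_ne_top hκt) hfin) main'
  have hκr : 0 < κ.toReal := ENNReal.toReal_pos hκ0 hκt
  rw [← ENNReal.ofReal_toReal hκt, ← ENNReal.ofReal_mul hQ0.le, mul_comm Q] at key
  rw [ENNReal.ofReal_div_of_pos (by positivity), ENNReal.div_eq_inv_mul, mul_assoc,
    ← ENNReal.mul_le_iff_le_inv (by positivity) ENNReal.ofReal_ne_top]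
  exact key

theorem lintegral_gagliardoKernel_le {N : ℕ} (hN : 2 ≤ N) {p q β c σ : ℝ}
    (hp : 1 < p) (hq : 0 ≤ q) (hσ : σ * p = 2 * (β - c)) (hpq : q - N < p) (hβ : β < N)
    (hβq : N < β + q) (hc : 2 * c + q < 2 * N) :
    ∃ C : ℝ, 0 ≤ C ∧ ∀ f g : Euc N → ℝ, Measurable f → hardyIntegral p q c f ≠ ∞ →
      (∀ x, x ≠ 0 → g x = ‖x‖ ^ σ * f x) →
      ∫⁻ x, ∫⁻ y, ENNReal.ofReal (gagliardoKernel p q β g x y) ≤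
        ENNReal.ofReal C * ∫⁻ x, ∫⁻ y, ENNReal.ofReal (gagliardoKernel p q c f x y) := by
  obtain ⟨C, hC, h₁⟩ := lintegral_gagliardoKernel_le_add_hardyIntegral hN hp hq hσ hpq hβ hβq
  obtain ⟨D, hD, h₂⟩ := hardyIntegral_le hN hp hq hc
  refine ⟨C * (1 + D), by positivity, fun f g hf hfin hfg => (h₁ f g hf hfg).trans ?_⟩
  rw [ENNReal.ofReal_mul hC, mul_assoc, ENNReal.ofReal_add zero_le_one hD, ENNReal.ofReal_one,
    add_mul, one_mul]
  exact mul_le_mul_right (add_le_add le_rfl (h₂ f hf hfin)) _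

theorem hardyIntegral_ne_top {N : ℕ} (hN : 2 ≤ N) {p q c : ℝ} (hp : 1 < p)
    (hc : 2 * c + q < 2 * N) {u : Euc N → ℝ} (hu : Continuous u) (hsupp : HasCompactSupport u) :
    hardyIntegral p q c u ≠ ∞ := by
  obtain ⟨K, hK⟩ := hsupp.exists_bound_of_continuous hu
  obtain ⟨R, hR⟩ := hsupp.isBounded.subset_closedBall (0 : Euc N)
  obtain ⟨C, -, hC⟩ := lintegral_norm_rpow_ball hN (r := -(2 * c) + (N - q)) (by linarith)
  have hR' : 0 < max R 1 := by positivity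
  have : hardyIntegral p q c u ≤ ENNReal.ofReal (K ^ p) * ENNReal.ofReal
      (C * max R 1 ^ ((N : ℝ) + (-(2 * c) + (N - q)))) := by
    rw [← hC _ hR', ← lintegral_const_mul' _ _ ENNReal.ofReal_ne_top, hardyIntegral]
    refine lintegral_mono_ae ?_
    filter_upwards [ae_ne_zero hN] with x hx
    have ha : 0 < ‖x‖ := norm_pos_iff.2 hx
    have hK0 : 0 ≤ K := (norm_nonneg _).trans (hK x)
    rw [← ENNReal.ofReal_mul (by positivity)]
    apply ENNReal.ofReal_le_ofReal
    split_ifs with h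
    · rw [mul_assoc, ← rpow_add ha]
      gcongr
      exact hK x
    · have : u x = 0 := by
        by_contra hne
        have := hR (subset_tsupport u hne)
        exact h ((by simpa using this : ‖x‖ ≤ R).trans (le_max_left _ _))
      simp [this, zero_rpow (by linarith : p ≠ 0)]
  exact (this.trans_lt (ENNReal.mul_lt_top ENNReal.ofReal_lt_top ENNReal.ofReal_lt_top)).ne

/-- **Equivalence `W^{s,p}_β(ℝ^N) = E_α(ℝ^N)` with `α = -2β/p`.** For `-ps < β < (N-ps)/2`
there are constants `C₁, C₂ > 0` such that for all `u ∈ C_c^∞(ℝ^N)`: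
`C₁ ∬ ||x|^α u(x)-|y|^α u(y)|^p/|x-y|^{N+ps} ≤ ∬ |u(x)-u(y)|^p/(|x-y|^{N+ps}|x|^β|y|^β)
  ≤ C₂ ∬ ||x|^α u(x)-|y|^α u(y)|^p/|x-y|^{N+ps}`. -/
theorem weighted_space_equivalence (N : ℕ) (hN : 2 ≤ N) (s p β : ℝ)
    (hs0 : 0 < s) (hs1 : s < 1) (hp1 : 1 < p) (hps : p * s < N)
    (hβ1 : -(p * s) < β) (hβ2 : β < ((N : ℝ) - p * s) / 2) :
    ∃ C₁ C₂ : ℝ, 0 < C₁ ∧ 0 < C₂ ∧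
      ∀ u : Euc N → ℝ, ContDiff ℝ (⊤ : ℕ∞) u → HasCompactSupport u →
        ENNReal.ofReal C₁ * weightedFunctionEnergy N p s (-(2 * β) / p) u ≤
            weightedGagliardoEnergy N p s β u ∧
          weightedGagliardoEnergy N p s β u ≤
            ENNReal.ofReal C₂ * weightedFunctionEnergy N p s (-(2 * β) / p) u := by
  have hps0 : 0 < p * s := by positivity
  have hps1 : p * s < p := mul_lt_of_lt_one_right (by linarith) hs1
  have hN0 : (0 : ℝ) < N := by linarith
  have hp0 : p ≠ 0 := by linarith
  obtain ⟨D₁, hD₁, h₁⟩ := lintegral_gagliardoKernel_le hN (p := p) (q := N + p * s) (β := 0)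
    (c := β) (σ := -(2 * β) / p) hp1 (by positivity) (by field_simp; ring) (by linarith)
    (by linarith) (by linarith) (by linarith)
  obtain ⟨D₂, hD₂, h₂⟩ := lintegral_gagliardoKernel_le hN (p := p) (q := N + p * s) (β := β)
    (c := 0) (σ := 2 * β / p) hp1 (by positivity) (by field_simp; ring) (by linarith)
    (by linarith) (by linarith) (by linarith)
  refine ⟨(D₁ + 1)⁻¹, D₂ + 1, by positivity, by positivity, fun u hu hsupp => ?_⟩
  set α := -(2 * β) / p with hα
  set v : Euc N → ℝ := fun x => ‖x‖ ^ α * u x with hv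
  have hum : Measurable u := hu.continuous.measurable
  have hvm : Measurable v := by fun_prop
  have hE : weightedFunctionEnergy N p s α u =
      ∫⁻ x, ∫⁻ y, ENNReal.ofReal (gagliardoKernel p (N + p * s) 0 v x y) := by
    simp [weightedFunctionEnergy, gagliardoKernel, hv]
  have hW : weightedGagliardoEnergy N p s β u =
      ∫⁻ x, ∫⁻ y, ENNReal.ofReal (gagliardoKernel p (N + p * s) β u x y) := rfl
  have hHu : hardyIntegral p (N + p * s) β u ≠ ∞ :=
    hardyIntegral_ne_top hN hp1 (by linarith) hu.continuous hsupp
  have hHv : hardyIntegral p (N + p * s) 0 v ≠ ∞ := by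
    have : hardyIntegral p (N + p * s) 0 v = hardyIntegral p (N + p * s) β u := by
      refine lintegral_congr_ae ?_
      filter_upwards [ae_ne_zero hN] with x hx
      rw [hv, abs_mul, abs_of_nonneg (by positivity), mul_rpow (by positivity) (abs_nonneg _),
        ← rpow_mul (norm_nonneg _), hα, div_mul_cancel₀ _ hp0, mul_zero, neg_zero, rpow_zero,
        mul_one, mul_comm (‖x‖ ^ (-(2 * β)))]
    rwa [this]
  rw [hE, hW]
  constructor
  · refine (mul_le_mul_right (h₁ u v hum hHu fun x _ => rfl) _).trans ?_
    rw [← mul_assoc, ← ENNReal.ofReal_mul (by positivity)]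
    refine mul_le_of_le_one_left' ?_
    rw [ENNReal.ofReal_le_one, inv_mul_le_iff₀ (by positivity)]
    linarith
  · refine (h₂ v u hvm hHv fun x hx => ?_).trans (by gcongr; linarith)
    have ha : 0 < ‖x‖ := norm_pos_iff.2 hx
    rw [hv, ← mul_assoc, ← rpow_add ha, hα, neg_div, add_neg_cancel, rpow_zero, one_mul]
end
end

section
/- Let N ≥ 2 be an integer, 0 < s < 1 and p > 1 with ps < N. For every λ with 0 < λ < Λ_{N,p,s} there exist η₁ and η₂ with 0 < η₁ < (N−ps)/p < η₂, η₂(p−1) < N, such that Θ(η₁) = Θ(η₂) = λ. -/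
open MeasureTheory Real Set Filter Metric
open scoped ENNReal Topology NNReal

noncomputable section

/-- The spherical kernel `K(σ)`. -/
def sphereKernel (N : ℕ) (p s : ℝ) (e : Euc N) (σ : ℝ) : ℝ :=
  ∫ y in Metric.sphere (0 : Euc N) 1, ‖e - σ • y‖ ^ (-((N : ℝ) + p * s)) ∂ μH[(N : ℝ) - 1]

/-- The optimal fractional Hardy constant `Λ_{N,p,s}`. -/
def hardyConst (N : ℕ) (p s : ℝ) (e : Euc N) : ℝ :=
  ∫ σ in Set.Ioo (0:ℝ) 1,
    σ ^ (p * s - 1) * (1 - σ ^ (((N : ℝ) - p * s) / p)) ^ p * sphereKernel N p s e σ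

/-- `Θ(η) = ∫_1^∞ K(σ)(σ^η-1)^{p-1}(σ^{N-1-η(p-1)} - σ^{ps-1}) dσ`. -/
def theta (N : ℕ) (p s η : ℝ) (e : Euc N) : ℝ :=
  ∫ σ in Set.Ioi (1:ℝ),
    sphereKernel N p s e σ * (σ ^ η - 1) ^ (p - 1) *
      (σ ^ ((N : ℝ) - 1 - η * (p - 1)) - σ ^ (p * s - 1))

/-- The kernel `K` is homogeneous under the inversion `σ ↦ σ⁻¹`. -/
lemma sphereKernel_inv (N : ℕ) (p s : ℝ) {e : Euc N} (he : ‖e‖ = 1) {σ : ℝ} (hσ : 0 < σ) :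
    sphereKernel N p s e σ⁻¹ = σ ^ ((N : ℝ) + p * s) * sphereKernel N p s e σ := by
  unfold sphereKernel
  rw [← integral_const_mul]
  refine setIntegral_congr_fun isClosed_sphere.measurableSet fun y hy => ?_
  have hy1 : ‖y‖ = 1 := by simpa using hy
  have hsq : ‖σ • e - y‖ = ‖e - σ • y‖ := by
    rw [← sq_eq_sq₀ (norm_nonneg _) (norm_nonneg _), norm_sub_sq_real, norm_sub_sq_real,
      norm_smul, norm_smul, real_inner_smul_left, real_inner_smul_right, he, hy1]
    ring
  have hnorm : ‖e - σ⁻¹ • y‖ = σ⁻¹ * ‖e - σ • y‖ := by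
    rw [← hsq, ← abs_of_pos (inv_pos.2 hσ), ← Real.norm_eq_abs, ← norm_smul, smul_sub, smul_smul,
      inv_mul_cancel₀ hσ.ne', one_smul, Real.norm_of_nonneg (inv_pos.2 hσ).le]
  simp only [hnorm]
  rw [mul_rpow (inv_pos.2 hσ).le (norm_nonneg _), inv_rpow hσ.le, rpow_neg hσ.le, inv_inv]

lemma sphereKernel_nonneg (N : ℕ) (p s : ℝ) (e : Euc N) (σ : ℝ) : 0 ≤ sphereKernel N p s e σ :=
  integral_nonneg fun _ => rpow_nonneg (norm_nonneg _) _

lemma one_sub_rpow_neg_nonneg {σ a : ℝ} (hσ : 1 < σ) (ha : 0 ≤ a) : 0 ≤ 1 - σ ^ (-a) :=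
  sub_nonneg.2 (rpow_le_one_of_one_le_of_nonpos hσ.le (neg_nonpos.2 ha))

lemma one_sub_rpow_neg_le {σ a b k : ℝ} (hσ : 1 < σ) (hk : 1 ≤ k) (hab : a ≤ k * b) :
    1 - σ ^ (-a) ≤ k * (1 - σ ^ (-b)) := by
  have hσ0 : 0 < σ := one_pos.trans hσ
  have hmono : σ ^ (-(k * b)) ≤ σ ^ (-a) := rpow_le_rpow_of_exponent_le hσ.le (by linarith)
  have hbern := one_add_mul_self_le_rpow_one_add
    (s := σ ^ (-b) - 1) (by linarith [rpow_pos_of_pos hσ0 (-b)]) hk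
  rw [add_sub_cancel, ← rpow_mul hσ0.le, show -b * k = -(k * b) by ring] at hbern
  linarith

/-- The integrand of `theta`, with the powers of `σ` collected. -/
lemma theta_integrand_eq {n p q η σ : ℝ} (hσ : 1 < σ) (hη : 0 ≤ η) :
    (σ ^ η - 1) ^ (p - 1) * (σ ^ (n - 1 - η * (p - 1)) - σ ^ (q - 1)) =
      σ ^ (n - 1) * ((1 - σ ^ (-η)) ^ (p - 1) * (1 - σ ^ (-(n - q - η * (p - 1))))) := by
  have hσ0 : 0 < σ := one_pos.trans hσ
  have h₁ : σ ^ η - 1 = σ ^ η * (1 - σ ^ (-η)) := by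
    rw [mul_sub, ← rpow_add hσ0]
    simp
  have h₂ : σ ^ (n - 1) = σ ^ (η * (p - 1)) * σ ^ (n - 1 - η * (p - 1)) := by
    rw [← rpow_add hσ0]
    ring_nf
  have h₃ : σ ^ (q - 1) = σ ^ (n - 1 - η * (p - 1)) * σ ^ (-(n - q - η * (p - 1))) := by
    rw [← rpow_add hσ0]
    ring_nf
  rw [h₁, mul_rpow (rpow_nonneg hσ0.le _) (one_sub_rpow_neg_nonneg hσ hη), ← rpow_mul hσ0.le,
    h₂, h₃]
  ring

/-- At the critical exponent the integrand of `theta` is the integrand of the Hardy constant,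
transported by the inversion `σ ↦ σ⁻¹`. -/
lemma theta_integrand_critical {N : ℕ} {p s : ℝ} {e : Euc N} (he : ‖e‖ = 1) {σ : ℝ} (hσ : 1 < σ) :
    |-(σ ^ 2)⁻¹| • (σ⁻¹ ^ (p * s - 1) * (1 - σ⁻¹ ^ (((N : ℝ) - p * s) / p)) ^ p *
        sphereKernel N p s e σ⁻¹) =
      σ ^ ((N : ℝ) - 1) * (1 - σ ^ (-(((N : ℝ) - p * s) / p))) ^ p * sphereKernel N p s e σ := by
  have hσ0 : 0 < σ := one_pos.trans hσ
  have hpow : σ ^ ((N : ℝ) - 1) = σ ^ (-2 : ℝ) * σ ^ (-(p * s - 1)) * σ ^ ((N : ℝ) + p * s) := by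
    rw [← rpow_add hσ0, ← rpow_add hσ0]
    ring_nf
  rw [sphereKernel_inv N p s he hσ0, inv_rpow hσ0.le, inv_rpow hσ0.le, ← rpow_neg hσ0.le,
    ← rpow_neg hσ0.le, abs_neg, abs_of_pos (by positivity), smul_eq_mul,
    show (σ ^ 2)⁻¹ = σ ^ (-2 : ℝ) by rw [rpow_neg hσ0.le]; norm_cast, hpow]
  ring

lemma image_inv_Ioi_one : (fun σ : ℝ => σ⁻¹) '' Ioi 1 = Ioo 0 1 := by
  ext x
  constructor
  · rintro ⟨y, hy, rfl⟩
    exact ⟨inv_pos.2 (one_pos.trans hy), inv_lt_one_of_one_lt₀ hy⟩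
  · rintro ⟨h0, h1⟩
    exact ⟨x⁻¹, (one_lt_inv₀ h0).2 h1, inv_inv x⟩

lemma hasDerivWithinAt_inv_Ioi_one {σ : ℝ} (hσ : σ ∈ Ioi (1 : ℝ)) :
    HasDerivWithinAt (fun σ : ℝ => σ⁻¹) (-(σ ^ 2)⁻¹) (Ioi 1) σ :=
  (hasDerivAt_inv (one_pos.trans hσ).ne').hasDerivWithinAt

lemma hardyConst_eq_integral_Ioi {N : ℕ} {p s : ℝ} {e : Euc N} (he : ‖e‖ = 1) :
    hardyConst N p s e = ∫ σ in Ioi (1 : ℝ),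
      σ ^ ((N : ℝ) - 1) * (1 - σ ^ (-(((N : ℝ) - p * s) / p))) ^ p * sphereKernel N p s e σ := by
  unfold hardyConst
  rw [← image_inv_Ioi_one, integral_image_eq_integral_abs_deriv_smul measurableSet_Ioi
    (fun _ => hasDerivWithinAt_inv_Ioi_one) inv_injective.injOn]
  exact setIntegral_congr_fun measurableSet_Ioi fun σ hσ => theta_integrand_critical he hσ

lemma theta_critical {N : ℕ} {p s : ℝ} (hp1 : 1 < p) (hps : p * s < N)
    {e : Euc N} (he : ‖e‖ = 1) :
    theta N p s (((N : ℝ) - p * s) / p) e = hardyConst N p s e := by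
  have hp0 : 0 < p := one_pos.trans hp1
  have hη : 0 < ((N : ℝ) - p * s) / p := div_pos (sub_pos.2 hps) hp0
  rw [hardyConst_eq_integral_Ioi he, theta]
  refine setIntegral_congr_fun measurableSet_Ioi fun σ hσ => ?_
  have hexp : (N : ℝ) - p * s - ((N : ℝ) - p * s) / p * (p - 1) = ((N : ℝ) - p * s) / p := by
    field_simp
    ring
  have hnn := one_sub_rpow_neg_nonneg hσ hη.le
  rw [mul_assoc, theta_integrand_eq hσ hη.le, hexp, ← rpow_add_one' hnn (by simpa using hp0.ne'),
    sub_add_cancel]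
  ring

lemma theta_zero {N : ℕ} {p s : ℝ} (hp1 : 1 < p) (e : Euc N) : theta N p s 0 e = 0 := by
  simp [theta, zero_rpow (sub_pos.2 hp1).ne']

lemma theta_eq_zero {N : ℕ} {p s : ℝ} (hp1 : 1 < p) (e : Euc N) :
    theta N p s (((N : ℝ) - p * s) / (p - 1)) e = 0 := by
  have h : (N : ℝ) - 1 - ((N : ℝ) - p * s) / (p - 1) * (p - 1) = p * s - 1 := by
    rw [div_mul_cancel₀ _ (sub_pos.2 hp1).ne']
    ring
  simp [theta, h]

/-- `Θ` is continuous between its two zeros as soon as the Hardy integral converges. -/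
lemma continuousOn_theta {N : ℕ} {p s : ℝ} (hp1 : 1 < p) (hps : p * s < N) (e : Euc N)
    (hint : IntegrableOn (fun σ : ℝ => σ ^ ((N : ℝ) - 1) *
      (1 - σ ^ (-(((N : ℝ) - p * s) / p))) ^ p * sphereKernel N p s e σ) (Ioi 1)) :
    ContinuousOn (fun η => theta N p s η e) (Icc 0 (((N : ℝ) - p * s) / (p - 1))) := by
  have hp0 : 0 < p := one_pos.trans hp1
  have hp10 : 0 < p - 1 := sub_pos.2 hp1
  have hM : 0 < (N : ℝ) - p * s := sub_pos.2 hps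
  set η₀ := ((N : ℝ) - p * s) / p with hη₀
  have hη₀pos : 0 < η₀ := div_pos hM hp0
  have hMη : (N : ℝ) - p * s = p * η₀ := by rw [hη₀]; field_simp
  have hK : AEStronglyMeasurable (fun σ => sphereKernel N p s e σ) (volume.restrict (Ioi 1)) := by
    have hw : Measurable fun σ : ℝ => (σ ^ ((N : ℝ) - 1) * (1 - σ ^ (-η₀)) ^ p)⁻¹ := by fun_prop
    refine (hint.aestronglyMeasurable.mul hw.aestronglyMeasurable).congr ?_
    refine (ae_restrict_iff' measurableSet_Ioi).2 (Eventually.of_forall fun σ hσ => ?_)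
    have hσ0 : 0 < σ := one_pos.trans hσ
    have h1 : 0 < 1 - σ ^ (-η₀) :=
      sub_pos.2 (rpow_lt_one_of_one_lt_of_neg hσ (neg_neg_of_pos hη₀pos))
    have h2 : 0 < σ ^ ((N : ℝ) - 1) * (1 - σ ^ (-η₀)) ^ p := by positivity
    simp only [Pi.mul_apply]
    rw [mul_right_comm, mul_inv_cancel₀ h2.ne', one_mul]
  set k : ℝ := p / (p - 1) + p with hk
  have hkp : 0 < p / (p - 1) := div_pos hp0 hp10
  have hk1 : 1 ≤ k := by linarith
  unfold theta
  refine continuousOn_of_dominated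
    (bound := fun σ => k ^ p * (σ ^ ((N : ℝ) - 1) * (1 - σ ^ (-η₀)) ^ p * sphereKernel N p s e σ))
    (fun η _ => ?_) (fun η hη => ?_) (hint.const_mul _) ?_
  · have hw : Measurable fun σ : ℝ => (σ ^ η - 1) ^ (p - 1) := by fun_prop
    have hv : Measurable fun σ : ℝ => σ ^ ((N : ℝ) - 1 - η * (p - 1)) - σ ^ (p * s - 1) := by
      fun_prop
    exact (hK.mul hw.aestronglyMeasurable).mul hv.aestronglyMeasurable
  · refine (ae_restrict_iff' measurableSet_Ioi).2 (Eventually.of_forall fun σ hσ => ?_)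
    have hσ0 : 0 < σ := one_pos.trans hσ
    have hηM : η * (p - 1) ≤ (N : ℝ) - p * s := (le_div_iff₀ hp10).1 hη.2
    have hηk : η ≤ k * η₀ := by
      have : ((N : ℝ) - p * s) / (p - 1) = p / (p - 1) * η₀ := by rw [hMη]; ring
      nlinarith [hη.2, mul_pos hp0 hη₀pos]
    have hek : (N : ℝ) - p * s - η * (p - 1) ≤ k * η₀ := by
      nlinarith [mul_nonneg hη.1 hp10.le, mul_pos hkp hη₀pos]
    have hA := one_sub_rpow_neg_nonneg hσ hη.1
    have hB := one_sub_rpow_neg_nonneg hσ (sub_nonneg.2 hηM)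
    have hD := one_sub_rpow_neg_nonneg hσ hη₀pos.le
    have hKn := sphereKernel_nonneg N p s e σ
    have hprod : (1 - σ ^ (-η)) ^ (p - 1) * (1 - σ ^ (-((N : ℝ) - p * s - η * (p - 1)))) ≤
        k ^ p * (1 - σ ^ (-η₀)) ^ p :=
      calc _ ≤ (k * (1 - σ ^ (-η₀))) ^ (p - 1) * (k * (1 - σ ^ (-η₀))) :=
            mul_le_mul (rpow_le_rpow hA (one_sub_rpow_neg_le hσ hk1 hηk) hp10.le)
              (one_sub_rpow_neg_le hσ hk1 hek) hB (by positivity)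
        _ = k ^ p * (1 - σ ^ (-η₀)) ^ p := by
            rw [← rpow_add_one' (by positivity) (by simpa using hp0.ne'), sub_add_cancel,
              mul_rpow (by positivity) hD]
    rw [mul_assoc, theta_integrand_eq hσ hη.1, Real.norm_of_nonneg (by positivity)]
    calc _ ≤ sphereKernel N p s e σ *
          (σ ^ ((N : ℝ) - 1) * (k ^ p * (1 - σ ^ (-η₀)) ^ p)) := by gcongr
      _ = _ := by ring
  · refine (ae_restrict_iff' measurableSet_Ioi).2 (Eventually.of_forall fun σ hσ => ?_)
    have hσ0 : σ ≠ 0 := (one_pos.trans hσ).ne'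
    have h₁ : Continuous fun η : ℝ => (σ ^ η - 1) ^ (p - 1) :=
      ((continuous_const_rpow hσ0).sub continuous_const).rpow_const fun _ => Or.inr hp10.le
    have h₂ : Continuous fun η : ℝ => σ ^ ((N : ℝ) - 1 - η * (p - 1)) :=
      (continuous_const_rpow hσ0).comp (by fun_prop)
    exact ((continuous_const.mul h₁).mul (h₂.sub continuous_const)).continuousOn

/-- **Two-level-set property of `Θ`.** For every `0 < λ < Λ_{N,p,s}` there exist
`0 < η₁ < (N-ps)/p < η₂` with `η₂(p-1) < N` such that `Θ(η₁) = Θ(η₂) = λ`. -/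
theorem theta_two_solutions (N : ℕ) (hN : 2 ≤ N) (s p : ℝ)
    (hs0 : 0 < s) (hs1 : s < 1) (hp1 : 1 < p) (hps : p * s < N)
    (e : Euc N) (he : ‖e‖ = 1) :
    ∀ lam : ℝ, 0 < lam → lam < hardyConst N p s e →
      ∃ η₁ η₂ : ℝ, 0 < η₁ ∧ η₁ < ((N : ℝ) - p * s) / p ∧
        ((N : ℝ) - p * s) / p < η₂ ∧ η₂ * (p - 1) < N ∧
        theta N p s η₁ e = lam ∧ theta N p s η₂ e = lam := by
  intro lam hlam hlt
  have hp0 : 0 < p := one_pos.trans hp1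
  have hp10 : 0 < p - 1 := sub_pos.2 hp1
  have hM : 0 < (N : ℝ) - p * s := sub_pos.2 hps
  have hcont := continuousOn_theta hp1 hps e <| by
    by_contra h
    rw [hardyConst_eq_integral_Ioi he, integral_undef h] at hlt
    exact hlam.not_gt hlt
  have h0 : 0 ≤ ((N : ℝ) - p * s) / p := (div_pos hM hp0).le
  have hle : ((N : ℝ) - p * s) / p ≤ ((N : ℝ) - p * s) / (p - 1) :=
    div_le_div_of_nonneg_left hM.le hp10 (by linarith)
  obtain ⟨η₁, ⟨h₁0, h₁⟩, hη₁⟩ := intermediate_value_Ioo h0 (hcont.mono (Icc_subset_Icc_right hle))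
    (show lam ∈ _ by simpa [theta_zero hp1, theta_critical hp1 hps he] using ⟨hlam, hlt⟩)
  obtain ⟨η₂, ⟨h₂, h₂b⟩, hη₂⟩ := intermediate_value_Ioo' hle (hcont.mono (Icc_subset_Icc_left h0))
    (show lam ∈ _ by simpa [theta_eq_zero hp1, theta_critical hp1 hps he] using ⟨hlam, hlt⟩)
  have h₂M : η₂ * (p - 1) < N - p * s := (lt_div_iff₀ hp10).1 h₂b
  exact ⟨η₁, η₂, h₁0, h₁, h₂, by linarith [mul_pos hp0 hs0], hη₁, hη₂⟩
end
end
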